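/- Let combinatorial triangulation data with vertices be given, in which every edge has two distinct endpoints, and let Δ : E → ℝ satisfy Δ(e) > 0 for every edge e (Condition 2.1). Then the following are equivalent: (a) for every nonempty set of faces 𝓕 ⊆ F, Σ_{e ∈ E′(𝓕)} n_𝓕(e)·δ′(e) ≥ 2π·χ(𝓕) − K(𝓕), with equality if and only if 𝓕 = F; (b) Condition (2.2) holds, i.e., excess(𝓕) > 0 for every nonempty proper 𝓕 ⊊ F and excess(F) = 0. -/

import Mathlib

open Finset Real

/-- The set `E(𝓕)` of edges of faces of `𝓕`. -/
def edgesOfFaces {F E C : Type} [Fintype C] [Fintype E] [DecidableEq F] [DecidableEq E]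
    (f : C → F) (o : C → E) (𝓕 : Finset F) : Finset E :=
  Finset.univ.filter (fun e => ∃ c, f c ∈ 𝓕 ∧ o c = e)

/-- The excess of a set of faces: `excess(𝓕) = (Σ_{e ∈ E(𝓕)} Δ(e)) − π·|𝓕|`. -/
noncomputable def excess {F E C : Type} [Fintype C] [Fintype E] [DecidableEq F] [DecidableEq E]
    (f : C → F) (o : C → E) (Δ : E → ℝ) (𝓕 : Finset F) : ℝ :=
  (∑ e ∈ edgesOfFaces f o 𝓕, Δ e) - π * 𝓕.card

/-- The set `V(𝓕)` of vertices of faces of `𝓕`. -/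
def vertsOfFaces {F C V : Type} [Fintype C] [DecidableEq F] [DecidableEq V]
    (f : C → F) (vt : C → V) (𝓕 : Finset F) : Finset V :=
  (Finset.univ.filter (fun c => f c ∈ 𝓕)).image vt

/-- Every endpoint of an edge of a face of `𝓕` is a vertex of a face of `𝓕`. -/
lemma ends_subset_vertsOfFaces {F E C V : Type} [Fintype E] [Fintype C]
    [DecidableEq F] [DecidableEq E] [DecidableEq V]
    {f : C → F} {o : C → E} {vt : C → V} {ends : E → Finset V}
    (hcompat : ∀ t : F, ∃ c₁ c₂ c₃ : C, c₁ ≠ c₂ ∧ c₁ ≠ c₃ ∧ c₂ ≠ c₃ ∧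
        (∀ c : C, f c = t ↔ (c = c₁ ∨ c = c₂ ∨ c = c₃)) ∧
        ends (o c₁) = {vt c₂, vt c₃} ∧ ends (o c₂) = {vt c₁, vt c₃} ∧
        ends (o c₃) = {vt c₁, vt c₂})
    {𝓕 : Finset F} {e : E} (he : e ∈ edgesOfFaces f o 𝓕) :
    ends e ⊆ vertsOfFaces f vt 𝓕 := by
  simp only [edgesOfFaces, mem_filter, mem_univ, true_and] at he
  obtain ⟨c, hc, rfl⟩ := he
  obtain ⟨c₁, c₂, c₃, -, -, -, hcorner, h₁, h₂, h₃⟩ := hcompat (f c)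
  have mem_verts : ∀ c', f c' = f c → vt c' ∈ vertsOfFaces f vt 𝓕 := fun c' h =>
    mem_image_of_mem vt (by simpa [h] using hc)
  have m₁ := mem_verts c₁ ((hcorner c₁).2 (by simp))
  have m₂ := mem_verts c₂ ((hcorner c₂).2 (by simp))
  have m₃ := mem_verts c₃ ((hcorner c₃).2 (by simp))
  rcases (hcorner c).1 rfl with h | h | h <;> rw [h]
  · simp [h₁, insert_subset_iff, m₂, m₃]
  · simp [h₂, insert_subset_iff, m₁, m₃]
  · simp [h₃, insert_subset_iff, m₁, m₂]

/-- Double counting of incidences between a vertex set `S` and the edges. -/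
lemma sum_sum_incident_eq_sum_card_mul {E V : Type} [Fintype E] [DecidableEq V]
    (ends : E → Finset V) (S : Finset V) (g : E → ℝ) :
    ∑ w ∈ S, ∑ e ∈ univ.filter (fun e => w ∈ ends e), g e
      = ∑ e, (((ends e).filter (fun w => w ∈ S)).card : ℝ) * g e := by
  simp_rw [sum_filter]
  rw [sum_comm]
  refine sum_congr rfl fun e _ => ?_
  rw [← sum_filter, sum_const, nsmul_eq_mul, filter_mem_eq_inter, filter_mem_eq_inter, inter_comm]

/-- If every edge of `A` has both its endpoints in `S`, then the sum of the cone angles over `S`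
splits into twice the sum over `A` and the sum over the other edges meeting `S`. -/
lemma sum_sum_incident_eq_add {E V : Type} [Fintype E] [DecidableEq E] [DecidableEq V]
    {ends : E → Finset V} (hends : ∀ e : E, (ends e).card = 2) {S : Finset V} {A : Finset E}
    (hA : ∀ e ∈ A, ends e ⊆ S) (g : E → ℝ) :
    ∑ w ∈ S, ∑ e ∈ univ.filter (fun e => w ∈ ends e), g e
      = 2 * ∑ e ∈ A, g e
        + ∑ e ∈ univ.filter (fun e => e ∉ A ∧ ∃ w ∈ ends e, w ∈ S),
            (((ends e).filter (fun w => w ∈ S)).card : ℝ) * g e := by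
  rw [sum_sum_incident_eq_sum_card_mul, ← sum_add_sum_compl A, mul_sum]
  congr 1
  · refine sum_congr rfl fun e he => ?_
    rw [filter_true_of_mem (hA e he), hends, Nat.cast_ofNat]
  · symm
    refine sum_subset (fun e he => ?_) fun e he hne => ?_
    · simpa using (mem_filter.1 he).2.1
    · have hempty : (ends e).filter (fun w => w ∈ S) = ∅ :=
        filter_eq_empty_iff.2 fun w hw hwS =>
          hne (mem_filter.2 ⟨mem_univ e, mem_compl.1 he, w, hw, hwS⟩)
      simp [hempty]

/-- **Theorem 4.3.** For triangulation data with vertices (each edge with two distinct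
endpoints) and `Δ` satisfying Condition 2.1, the following are equivalent:
(a) for every nonempty set of faces `𝓕`,
`Σ_{e ∈ E′(𝓕)} n_𝓕(e)·δ′(e) ≥ 2π·χ(𝓕) − K(𝓕)`, with equality iff `𝓕 = F`;
(b) Condition 2.2: `excess(𝓕) > 0` for every nonempty proper `𝓕 ⊊ F` and `excess(F) = 0`. -/
theorem curvature_conditions_iff
    (F E C V : Type) [Fintype F] [Fintype E] [Fintype C] [Fintype V]
    [DecidableEq F] [DecidableEq E] [DecidableEq C] [DecidableEq V]
    (f : C → F) (o : C → E) (vt : C → V) (ends : E → Finset V)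
    (hface : ∀ t : F, (Finset.univ.filter (fun c => f c = t)).card = 3)
    (hedge : ∀ e : E, (Finset.univ.filter (fun c => o c = e)).card = 1 ∨
                      (Finset.univ.filter (fun c => o c = e)).card = 2)
    (hends : ∀ e : E, (ends e).card = 2)
    (hcompat : ∀ t : F, ∃ c₁ c₂ c₃ : C, c₁ ≠ c₂ ∧ c₁ ≠ c₃ ∧ c₂ ≠ c₃ ∧
        (∀ c : C, f c = t ↔ (c = c₁ ∨ c = c₂ ∨ c = c₃)) ∧
        ends (o c₁) = {vt c₂, vt c₃} ∧ ends (o c₂) = {vt c₁, vt c₃} ∧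
        ends (o c₃) = {vt c₁, vt c₂})
    (Δ : E → ℝ)
    -- Condition 2.1:
    (h21 : ∀ e : E, 0 < Δ e) :
    -- (a)
    ((∀ 𝓕 : Finset F, 𝓕.Nonempty →
        (2 * π * (((vertsOfFaces f vt 𝓕).card : ℝ)
                  - ((edgesOfFaces f o 𝓕).card : ℝ) + (𝓕.card : ℝ))
          - ∑ w ∈ vertsOfFaces f vt 𝓕,
              (2 * π - ∑ e ∈ Finset.univ.filter (fun e => w ∈ ends e), (π - Δ e)))
          ≤ ∑ e ∈ Finset.univ.filter (fun e => e ∉ edgesOfFaces f o 𝓕 ∧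
                ∃ w ∈ ends e, w ∈ vertsOfFaces f vt 𝓕),
              (((ends e).filter (fun w => w ∈ vertsOfFaces f vt 𝓕)).card : ℝ) * (π - Δ e) ∧
        ((∑ e ∈ Finset.univ.filter (fun e => e ∉ edgesOfFaces f o 𝓕 ∧
                ∃ w ∈ ends e, w ∈ vertsOfFaces f vt 𝓕),
              (((ends e).filter (fun w => w ∈ vertsOfFaces f vt 𝓕)).card : ℝ) * (π - Δ e))
          = 2 * π * (((vertsOfFaces f vt 𝓕).card : ℝ)
                  - ((edgesOfFaces f o 𝓕).card : ℝ) + (𝓕.card : ℝ))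
            - ∑ w ∈ vertsOfFaces f vt 𝓕,
                (2 * π - ∑ e ∈ Finset.univ.filter (fun e => w ∈ ends e), (π - Δ e))
          ↔ 𝓕 = Finset.univ)))
    ↔
    -- (b)
    ((∀ 𝓕 : Finset F, 𝓕.Nonempty → 𝓕 ≠ Finset.univ → 0 < excess f o Δ 𝓕) ∧
     excess f o Δ (Finset.univ : Finset F) = 0) := by
  have two_mul_excess : ∀ 𝓕 : Finset F,
      (∑ e ∈ univ.filter (fun e => e ∉ edgesOfFaces f o 𝓕 ∧
          ∃ w ∈ ends e, w ∈ vertsOfFaces f vt 𝓕),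
        (((ends e).filter (fun w => w ∈ vertsOfFaces f vt 𝓕)).card : ℝ) * (π - Δ e))
      = 2 * π * (((vertsOfFaces f vt 𝓕).card : ℝ)
            - ((edgesOfFaces f o 𝓕).card : ℝ) + (𝓕.card : ℝ))
          - ∑ w ∈ vertsOfFaces f vt 𝓕,
              (2 * π - ∑ e ∈ univ.filter (fun e => w ∈ ends e), (π - Δ e))
        + 2 * excess f o Δ 𝓕 := by
    intro 𝓕
    rw [sum_sub_distrib, sum_sum_incident_eq_add hends
      (fun e he => ends_subset_vertsOfFaces hcompat he)]
    simp only [excess, sum_sub_distrib, sum_const, nsmul_eq_mul]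
    ring
  have excess_empty : excess f o Δ ∅ = 0 := by simp [excess, edgesOfFaces]
  simp only [two_mul_excess, le_add_iff_nonneg_right, add_eq_left, mul_eq_zero,
    OfNat.ofNat_ne_zero, false_or, Nat.ofNat_pos, mul_nonneg_iff_of_pos_left]
  constructor
  · refine fun h => ⟨fun 𝓕 hne hproper =>
      lt_of_le_of_ne (h 𝓕 hne).1 fun h0 => hproper ((h 𝓕 hne).2.1 h0.symm), ?_⟩
    rcases (univ : Finset F).eq_empty_or_nonempty with hF | hF
    · rw [hF, excess_empty]
    · exact (h univ hF).2.2 rfl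
  · rintro ⟨hpos, hzero⟩ 𝓕 hne
    by_cases hF : 𝓕 = univ
    · simp [hF, hzero]
    · have := hpos 𝓕 hne hF
      simp [hF, this.le, this.ne']
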